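/- There exist a smooth function u₀ : 𝕋 → ℝ with zero mean and ‖∂ₓu₀‖_{L²(𝕋)} ≤ 1, and a constant c₀ > 0, such that for every family (u^ν)_{ν>0}, where for each ν > 0 the function u^ν : [0,∞) × 𝕋 → ℝ is a smooth solution of the viscous Burgers equation ∂ₜu^ν + u^ν ∂ₓu^ν = ν ∂ₓ²u^ν with u^ν(0,·) = u₀, one has liminf_{ν → 0⁺} ν · sup_{t ≥ 0} ∫_𝕋 (∂ₓu^ν(t,x))² dx ≥ c₀. -/

import Mathlib

open MeasureTheory

def BSm (f : ℝ → ℝ → ℝ) : Prop :=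
  ContDiffOn ℝ (⊤ : ℕ∞) (Function.uncurry f) (Set.Ici 0 ×ˢ Set.univ)

lemma bs_unique : UniqueDiffOn ℝ ((Set.Ici (0:ℝ)) ×ˢ (Set.univ : Set ℝ)) :=
  (uniqueDiffOn_Ici 0).prod uniqueDiffOn_univ

lemma BSm.hasDeriv {f : ℝ → ℝ → ℝ} (h : BSm f) {t : ℝ} (ht : 0 ≤ t) (x : ℝ) :
    HasDerivAt (f t) (fderivWithin ℝ (Function.uncurry f) (Set.Ici 0 ×ˢ Set.univ) (t, x) (0, 1)) x := by
  have h1 : HasFDerivWithinAt (Function.uncurry f) _ (Set.Ici 0 ×ˢ Set.univ) (t, x) :=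
    ((h.differentiableOn (by simp)) (t, x) ⟨ht, trivial⟩).hasFDerivWithinAt
  have h2 : HasDerivWithinAt (fun y : ℝ => ((t, y) : ℝ × ℝ)) (0, 1) Set.univ x :=
    ((hasDerivAt_const x t).prodMk (hasDerivAt_id x)).hasDerivWithinAt
  have h3 := h1.comp_hasDerivWithinAt x h2 (fun y _ => ⟨ht, trivial⟩)
  rw [hasDerivWithinAt_univ] at h3
  exact h3

lemma BSm.dx {f : ℝ → ℝ → ℝ} (h : BSm f) : BSm (fun t x => deriv (f t) x) := by
  have h1 : ContDiffOn ℝ (⊤ : ℕ∞)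
      (fderivWithin ℝ (Function.uncurry f) (Set.Ici 0 ×ˢ Set.univ)) (Set.Ici 0 ×ˢ Set.univ) :=
    h.fderivWithin bs_unique (by simp)
  have h2 : ContDiffOn ℝ (⊤ : ℕ∞) (fun p : ℝ × ℝ =>
      fderivWithin ℝ (Function.uncurry f) (Set.Ici 0 ×ˢ Set.univ) p (0, 1))
      (Set.Ici 0 ×ˢ Set.univ) := h1.clm_apply contDiffOn_const
  refine h2.congr ?_
  rintro ⟨t, x⟩ ⟨ht, -⟩
  exact (h.hasDeriv ht x).deriv

lemma BSm.cd {f : ℝ → ℝ → ℝ} (h : BSm f) {t : ℝ} (ht : 0 ≤ t) : ContDiff ℝ (⊤ : ℕ∞) (f t) := by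
  rw [← contDiffOn_univ]
  exact h.comp (g := Function.uncurry f) (f := fun y : ℝ => ((t, y) : ℝ × ℝ))
    (contDiff_const.prodMk contDiff_id).contDiffOn
    (fun y _ => ⟨ht, trivial⟩)

lemma BSm.dX {f : ℝ → ℝ → ℝ} (h : BSm f) {t : ℝ} (ht : 0 ≤ t) (x : ℝ) :
    HasDerivAt (f t) (deriv (f t) x) x :=
  (h.hasDeriv ht x).differentiableAt.hasDerivAt

lemma BSm.at {f : ℝ → ℝ → ℝ} (h : BSm f) {t : ℝ} (ht : 0 < t) (x : ℝ) :
    ContDiffAt ℝ (⊤ : ℕ∞) (Function.uncurry f) (t, x) := by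
  refine h.contDiffAt ?_
  exact prod_mem_nhds (Ici_mem_nhds ht) Filter.univ_mem

lemma BSm.hasDerivT {f : ℝ → ℝ → ℝ} (h : BSm f) {t : ℝ} (ht : 0 < t) (x : ℝ) :
    HasDerivAt (fun s => f s x) (fderiv ℝ (Function.uncurry f) (t, x) (1, 0)) t := by
  have h1 := ((h.at ht x).differentiableAt (by simp)).hasFDerivAt
  have h2 : HasDerivAt (fun s : ℝ => ((s, x) : ℝ × ℝ)) (1, 0) t :=
    (hasDerivAt_id t).prodMk (hasDerivAt_const t x)
  exact h1.comp_hasDerivAt t h2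

lemma BSm.hasDerivX {f : ℝ → ℝ → ℝ} (h : BSm f) {t : ℝ} (ht : 0 < t) (x : ℝ) :
    HasDerivAt (f t) (fderiv ℝ (Function.uncurry f) (t, x) (0, 1)) x := by
  have h1 := ((h.at ht x).differentiableAt (by simp)).hasFDerivAt
  have h2 : HasDerivAt (fun y : ℝ => ((t, y) : ℝ × ℝ)) (0, 1) x :=
    (hasDerivAt_const x t).prodMk (hasDerivAt_id x)
  exact h1.comp_hasDerivAt x h2

lemma BSm.dT {f : ℝ → ℝ → ℝ} (h : BSm f) {t : ℝ} (ht : 0 < t) (x : ℝ) :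
    HasDerivAt (fun s => f s x) (deriv (fun s => f s x) t) t :=
  (h.hasDerivT ht x).differentiableAt.hasDerivAt

lemma clm_curve {G : ℝ × ℝ → (ℝ × ℝ →L[ℝ] ℝ)} {G' : ℝ × ℝ →L[ℝ] (ℝ × ℝ →L[ℝ] ℝ)}
    {c : ℝ → ℝ × ℝ} {c' v : ℝ × ℝ} {t : ℝ} (hG : HasFDerivAt G G' (c t)) (hc : HasDerivAt c c' t) :
    HasDerivAt (fun s => G (c s) v) (G' c' v) t := by
  have h1 : HasDerivAt (fun s => G (c s)) (G' c') t := hG.comp_hasDerivAt t hc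
  have h2 := h1.clm_apply (hasDerivAt_const t v)
  simpa using h2

lemma two_le_tp : (2 : WithTop ℕ∞) ≤ ((⊤ : ℕ∞) : WithTop ℕ∞) :=
  WithTop.coe_le_coe.2 (le_top : (2:ℕ∞) ≤ ⊤)

lemma BSm.mixed {f : ℝ → ℝ → ℝ} (h : BSm f) {t : ℝ} (ht : 0 < t) (x : ℝ) :
    deriv (fun s => deriv (f s) x) t = deriv (fun y => deriv (fun s => f s y) t) x := by
  have hc := h.at ht x
  have hd : HasFDerivAt (fderiv ℝ (Function.uncurry f)) _ (t, x) :=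
    ((hc.fderiv_right (m := 1) (by rw [one_add_one_eq_two]; exact two_le_tp)).differentiableAt (by simp)).hasFDerivAt
  have hs : IsSymmSndFDerivAt ℝ (Function.uncurry f) (t, x) :=
    hc.isSymmSndFDerivAt (by simp; exact two_le_tp)
  have e1 : HasDerivAt (fun s => fderiv ℝ (Function.uncurry f) (s, x) (0, 1))
      (fderiv ℝ (fderiv ℝ (Function.uncurry f)) (t, x) (1, 0) (0, 1)) t := by
    have h2 : HasDerivAt (fun s : ℝ => ((s, x) : ℝ × ℝ)) (1, 0) t :=
      (hasDerivAt_id t).prodMk (hasDerivAt_const t x)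
    exact clm_curve hd h2
  have e2 : HasDerivAt (fun y => fderiv ℝ (Function.uncurry f) (t, y) (1, 0))
      (fderiv ℝ (fderiv ℝ (Function.uncurry f)) (t, x) (0, 1) (1, 0)) x := by
    have h2 : HasDerivAt (fun y : ℝ => ((t, y) : ℝ × ℝ)) (0, 1) x :=
      (hasDerivAt_const x t).prodMk (hasDerivAt_id x)
    exact clm_curve hd h2
  have e3 : (fun y => deriv (fun s => f s y) t)
      = fun y => fderiv ℝ (Function.uncurry f) (t, y) (1, 0) := by
    funext y; exact (h.hasDerivT ht y).deriv
  have e4 : (fun s => deriv (f s) x) =ᶠ[nhds t]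
      fun s => fderiv ℝ (Function.uncurry f) (s, x) (0, 1) := by
    filter_upwards [lt_mem_nhds ht] with s hs'
    exact (h.hasDerivX hs' x).deriv
  rw [e3, e4.deriv_eq, e1.deriv, e2.deriv]
  exact hs _ _

lemma snd_le_of_max {f : ℝ → ℝ} (hf : Continuous f) {x : ℝ} (hx : ∀ y, f y ≤ f x) :
    deriv f x = 0 ∧ deriv (deriv f) x ≤ 0 := by
  have hm : IsLocalMax f x := Filter.Eventually.of_forall hx
  refine ⟨hm.deriv_eq_zero, ?_⟩
  by_contra! hp
  have hmin := isLocalMin_of_deriv_deriv_pos hp hm.deriv_eq_zero hf.continuousAt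
  have he : f =ᶠ[nhds x] fun _ => f x := by
    filter_upwards [hmin] with y hy
    exact le_antisymm (hx y) hy
  have : deriv (deriv f) x = 0 := by
    rw [he.deriv.deriv_eq]; simp
  linarith

lemma per_int {f : ℝ → ℝ} (hp : ∀ x, f (x + 1) = f x) (x : ℝ) :
    ∃ y ∈ Set.Icc (0:ℝ) 1, f y = f x := by
  have hp' : Function.Periodic f 1 := hp
  obtain ⟨y, hy, h⟩ := hp'.exists_mem_Ico₀ one_pos x
  exact ⟨y, ⟨hy.1, hy.2.le⟩, h.symm⟩

lemma max_principle {h : ℝ → ℝ → ℝ} {C : ℝ}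
    (hc : ContinuousOn (Function.uncurry h) (Set.Ici 0 ×ˢ Set.univ))
    (hp : ∀ t x, h t (x + 1) = h t x) (h0 : ∀ x, h 0 x ≤ C)
    (hpde : ∀ t x, 0 < t → C < h t x → deriv (h t) x = 0 → deriv (deriv (h t)) x ≤ 0 →
      deriv (fun s => h s x) t < 0) (T : ℝ) (hT : 0 ≤ T) (x : ℝ) : h T x ≤ C := by
  have hK : IsCompact (Set.Icc (0:ℝ) T ×ˢ Set.Icc (0:ℝ) 1) := isCompact_Icc.prod isCompact_Icc
  obtain ⟨⟨t, z⟩, ⟨ht, hz⟩, hmax⟩ := hK.exists_isMaxOn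
    ⟨(0, 0), ⟨le_rfl, hT⟩, ⟨le_rfl, zero_le_one⟩⟩
    (hc.mono (fun p hp => ⟨hp.1.1, trivial⟩))
  have hmax' : ∀ s ∈ Set.Icc 0 T, ∀ y, h s y ≤ h t z := by
    intro s hs y
    obtain ⟨y', hy', e⟩ := per_int (hp s) y
    rw [← e]
    exact hmax (show (s, y') ∈ _ from ⟨hs, hy'⟩)
  by_contra! hcon
  have hC : C < h t z := hcon.trans_le (hmax' T ⟨hT, le_rfl⟩ x)
  have htpos : 0 < t := by
    rcases ht.1.lt_or_eq with h1 | h1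
    · exact h1
    · simp only at h1 hC; rw [← h1] at hC; exact absurd (h0 z) (not_le.2 hC)
  have hcont : Continuous (h t) := by
    rw [← continuousOn_univ]
    exact hc.comp (g := Function.uncurry h) (f := fun y : ℝ => ((t, y) : ℝ × ℝ))
      (by fun_prop) (fun y _ => ⟨ht.1, trivial⟩)
  obtain ⟨d1, d2⟩ := snd_le_of_max hcont (x := z) (hmax' t ht)
  have d3 := hpde t z htpos hC d1 d2
  have hda : HasDerivAt (fun s => h s z) (deriv (fun s => h s z) t) t :=
    (differentiableAt_of_deriv_ne_zero d3.ne).hasDerivAt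
  have hs := (hasDerivAt_iff_tendsto_slope.1 hda).eventually_lt_const d3
  have hs2 : ∀ᶠ s in nhdsWithin t (Set.Iio t), slope (fun s => h s z) t s < 0 :=
    hs.filter_mono (nhdsWithin_mono _ (fun s (hs : s < t) => hs.ne))
  have hs3 : ∀ᶠ s in nhdsWithin t (Set.Iio t), s ∈ Set.Ioo 0 t := Ioo_mem_nhdsLT htpos
  obtain ⟨s, hs4, hs5⟩ := (hs2.and hs3).exists
  rw [slope_def_field] at hs4
  have := hmax' s ⟨hs5.1.le, hs5.2.le.trans ht.2⟩ z
  have h6 : 0 ≤ (h s z - h t z) / (s - t) :=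
    div_nonneg_of_nonpos (by linarith) (by linarith [hs5.2])
  linarith

lemma time_int {h q : ℝ → ℝ → ℝ}
    (hc : ContinuousOn (Function.uncurry h) (Set.Ici 0 ×ˢ Set.univ))
    (qc : ContinuousOn (Function.uncurry q) (Set.Ici 0 ×ˢ Set.univ))
    (hd : ∀ t x, 0 < t → HasDerivAt (fun s => h s x) (q t x) t) (T : ℝ) (hT : 0 ≤ T) :
    (∫ x in (0:ℝ)..1, h T x) - (∫ x in (0:ℝ)..1, h 0 x)
      = ∫ t in (0:ℝ)..T, ∫ x in (0:ℝ)..1, q t x := by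
  have slT : ∀ {k : ℝ → ℝ → ℝ}, ContinuousOn (Function.uncurry k) (Set.Ici 0 ×ˢ Set.univ) →
      ∀ x, ContinuousOn (fun s => k s x) (Set.Ici 0) := by
    intro k hk x
    exact hk.comp (g := Function.uncurry k) (f := fun s : ℝ => ((s, x) : ℝ × ℝ))
      (by fun_prop) (fun y hy => ⟨hy, trivial⟩)
  have slX : ∀ t, 0 ≤ t → Continuous (h t) := by
    intro t ht
    rw [← continuousOn_univ]
    exact hc.comp (g := Function.uncurry h) (f := fun y : ℝ => ((t, y) : ℝ × ℝ))
      (by fun_prop) (fun y _ => ⟨ht, trivial⟩)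
  have e1 : ∀ x, ∫ t in (0:ℝ)..T, q t x = h T x - h 0 x := by
    intro x
    refine intervalIntegral.integral_eq_sub_of_hasDerivAt_of_le hT
      ((slT hc x).mono (fun s hs => hs.1)) (fun t ht => hd t x ht.1) ?_
    exact ContinuousOn.intervalIntegrable (((slT qc x)).mono (by
      rw [Set.uIcc_of_le hT]; exact fun s hs => hs.1))
  rw [← intervalIntegral.integral_sub ((slX T hT).intervalIntegrable _ _)
    ((slX 0 le_rfl).intervalIntegrable _ _)]
  simp_rw [← e1]
  symm
  simp_rw [intervalIntegral.integral_of_le (zero_le_one : (0:ℝ) ≤ 1)]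
  apply intervalIntegral_integral_swap
  have : IntegrableOn (Function.uncurry q) (Set.Icc (0:ℝ) T ×ˢ Set.Icc (0:ℝ) 1)
      (volume.prod volume) :=
    ContinuousOn.integrableOn_compact (isCompact_Icc.prod isCompact_Icc)
      (qc.mono (fun p hp => ⟨hp.1.1, trivial⟩))
  rw [Measure.prod_restrict]
  refine this.mono_set ?_
  rw [Set.uIoc_of_le hT]
  exact Set.prod_mono Set.Ioc_subset_Icc_self Set.Ioc_subset_Icc_self

structure Bur (ν : ℝ) (u : ℝ → ℝ → ℝ) : Prop where
  pos : 0 < ν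
  sm : BSm u
  per : ∀ t x, u t (x + 1) = u t x
  pde : ∀ t x, 0 < t →
    deriv (fun s => u s x) t + u t x * deriv (u t) x = ν * deriv (deriv (u t)) x

namespace Bur
variable {ν : ℝ} {u : ℝ → ℝ → ℝ}

lemma ut (h : Bur ν u) {t : ℝ} (ht : 0 < t) (x : ℝ) :
    HasDerivAt (fun s => u s x) (ν * deriv (deriv (u t)) x - u t x * deriv (u t) x) t := by
  rw [← h.pde t x ht, add_sub_cancel_right]
  exact h.sm.dT ht x

lemma hx1 (h : Bur ν u) {t : ℝ} (ht : 0 ≤ t) (x : ℝ) :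
    HasDerivAt (u t) (deriv (u t) x) x := h.sm.dX ht x

lemma hx2 (h : Bur ν u) {t : ℝ} (ht : 0 ≤ t) (x : ℝ) :
    HasDerivAt (deriv (u t)) (deriv (deriv (u t)) x) x := h.sm.dx.dX ht x

lemma hx3 (h : Bur ν u) {t : ℝ} (ht : 0 ≤ t) (x : ℝ) :
    HasDerivAt (deriv (deriv (u t))) (deriv (deriv (deriv (u t))) x) x := h.sm.dx.dx.dX ht x

lemma wt (h : Bur ν u) {t : ℝ} (ht : 0 < t) (x : ℝ) :
    HasDerivAt (fun s => deriv (u s) x)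
      (ν * deriv (deriv (deriv (u t))) x
        - (deriv (u t) x * deriv (u t) x + u t x * deriv (deriv (u t)) x)) t := by
  have h1 := h.sm.dx.dT ht x
  have e : (fun y => deriv (fun s => u s y) t)
      = fun y => ν * deriv (deriv (u t)) y - u t y * deriv (u t) y := by
    funext y; exact (h.ut ht y).deriv
  have h2 : HasDerivAt (fun y => ν * deriv (deriv (u t)) y - u t y * deriv (u t) y) _ x :=
    ((h.hx3 ht.le x).const_mul ν).sub ((h.hx1 ht.le x).mul (h.hx2 ht.le x))
  rw [h.sm.mixed ht x, e, h2.deriv] at h1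
  exact h1

lemma per' (h : Bur ν u) (t x : ℝ) : deriv (u t) (x + 1) = deriv (u t) x := by
  rw [← deriv_comp_add_const]
  congr 1
  funext y; exact h.per t y

lemma oleinik (h : Bur ν u) (h0 : ∀ x, deriv (u 0) x ≤ 1) {t : ℝ} (ht : 0 ≤ t) (x : ℝ) :
    (t + 1) * deriv (u t) x ≤ 1 := by
  refine max_principle (h := fun t x => (t + 1) * deriv (u t) x) (C := 1) ?_ ?_ ?_ ?_ t ht x
  · have := h.sm.dx.continuousOn
    exact ContinuousOn.mul (by fun_prop) this
  · intro t x; simp only [h.per']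
  · intro x; simpa using h0 x
  · intro t x ht hC d1 d2
    have e : deriv (fun x => (t + 1) * deriv (u t) x)
        = fun x => (t + 1) * deriv (deriv (u t)) x := by
      funext y; exact ((h.hx2 ht.le y).const_mul _).deriv
    simp only [e] at d1 d2
    rw [((h.hx3 ht.le x).const_mul _).deriv] at d2
    have h1 : HasDerivAt (fun s => (s + 1) * deriv (u s) x) _ t :=
      ((hasDerivAt_id t).add_const 1).mul (h.wt ht x)
    rw [h1.deriv]
    have ht1 : 0 < t + 1 := by linarith
    have d1' : deriv (deriv (u t)) x = 0 := by
      rcases mul_eq_zero.1 d1 with h | h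
      · linarith
      · exact h
    have hw : 0 < deriv (u t) x := by
      by_contra! hn
      have := mul_nonpos_of_nonneg_of_nonpos ht1.le hn
      linarith
    simp only [id, d1']
    have := mul_nonpos_of_nonneg_of_nonpos h.pos.le d2
    have := mul_pos hw (sub_pos.2 hC)
    nlinarith

lemma lower (h : Bur ν u) (h0 : ∀ x, -1 ≤ deriv (u 0) x) (h1 : ∀ x, (u 0 x) ^ 2 ≤ 1)
    {T : ℝ} (hT : 0 ≤ T) (x : ℝ) : -(ν + 1) ≤ ν * deriv (u T) x := by
  have key : ∀ ε > 0, (u T x) ^ 2 / 2 - ν * deriv (u T) x - ε * T ≤ ν + 1 := by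
    intro ε hε
    refine max_principle (h := fun t x => (u t x) ^ 2 / 2 - ν * deriv (u t) x - ε * t)
      (C := ν + 1) ?_ ?_ ?_ ?_ T hT x
    · have a := h.sm.continuousOn
      have b := h.sm.dx.continuousOn
      exact (((a.pow 2).div_const 2).sub (b.const_mul ν)).sub (by fun_prop)
    · intro t x; simp only [h.per', h.per]
    · intro x
      have := mul_le_mul_of_nonneg_left (h0 x) h.pos.le
      linarith [h1 x]
    · intro t x ht hC d1 d2
      have e : deriv (fun x => (u t x) ^ 2 / 2 - ν * deriv (u t) x - ε * t)
          = fun x => u t x * deriv (u t) x - ν * deriv (deriv (u t)) x := by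
        funext y
        have : HasDerivAt (fun x => (u t x) ^ 2 / 2 - ν * deriv (u t) x - ε * t) _ y :=
          ((((h.hx1 ht.le y).pow 2).div_const 2).sub ((h.hx2 ht.le y).const_mul ν)).sub_const _
        rw [this.deriv]
        push_cast; ring
      simp only [e] at d1 d2
      have h2 : HasDerivAt (fun y => u t y * deriv (u t) y - ν * deriv (deriv (u t)) y) _ x :=
        ((h.hx1 ht.le x).mul (h.hx2 ht.le x)).sub ((h.hx3 ht.le x).const_mul ν)
      rw [h2.deriv] at d2
      have h3 : HasDerivAt (fun s => (u s x) ^ 2 / 2 - ν * deriv (u s) x - ε * s) _ t :=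
        ((((h.ut ht x).pow 2).div_const 2).sub ((h.wt ht x).const_mul ν)).sub
          ((hasDerivAt_id t).const_mul ε)
      rw [h3.deriv]
      have := mul_nonpos_of_nonneg_of_nonpos h.pos.le d2
      have e4 : ν * deriv (deriv (u t)) x - u t x * deriv (u t) x = 0 := by linarith
      rw [e4]
      simp only [mul_zero, mul_one]
      linarith
  have : ν * deriv (u T) x ≥ -(ν + 1) + (u T x) ^ 2 / 2 := by
    by_contra! hn
    set d := -(ν + 1) + (u T x) ^ 2 / 2 - ν * deriv (u T) x with hd
    have hdp : 0 < d := by linarith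
    have := key (d / (T + 1) / 2) (by positivity)
    have h5 : d / (T + 1) / 2 * T ≤ d / 2 := by
      rw [div_div, div_mul_eq_mul_div, div_le_div_iff₀ (by positivity) (by positivity)]
      nlinarith
    linarith
  linarith [sq_nonneg (u T x)]

lemma cx (h : Bur ν u) {t : ℝ} (ht : 0 ≤ t) : Continuous (u t) := (h.sm.cd ht).continuous
lemma cx1 (h : Bur ν u) {t : ℝ} (ht : 0 ≤ t) : Continuous (deriv (u t)) :=
  (h.sm.dx.cd ht).continuous
lemma cx2 (h : Bur ν u) {t : ℝ} (ht : 0 ≤ t) : Continuous (deriv (deriv (u t))) :=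
  (h.sm.dx.dx.cd ht).continuous

lemma int_deriv (h : Bur ν u) {t : ℝ} (ht : 0 ≤ t) : ∫ x in (0:ℝ)..1, deriv (u t) x = 0 := by
  rw [intervalIntegral.integral_eq_sub_of_hasDerivAt (fun x _ => h.hx1 ht x)
    ((h.cx1 ht).intervalIntegrable _ _)]
  have := h.per t 0
  rw [zero_add] at this
  rw [this, sub_self]

lemma upper (h : Bur ν u) (h0 : ∀ x, |deriv (u 0) x| ≤ 1) (h1 : ∀ x, (u 0 x) ^ 2 ≤ 1)
    {t : ℝ} (ht : 0 ≤ t) : ν * ∫ x in (0:ℝ)..1, (deriv (u t) x) ^ 2 ≤ ν + 1 := by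
  have hp : ∀ x, ν * (deriv (u t) x) ^ 2 ≤ (ν + 1) - deriv (u t) x := by
    intro x
    have a := h.oleinik (fun x => (abs_le.1 (h0 x)).2) ht x
    have b := h.lower (fun x => (abs_le.1 (h0 x)).1) h1 ht x
    have a' : deriv (u t) x ≤ 1 := by
      by_contra! hn
      nlinarith
    nlinarith [mul_nonneg (sub_nonneg.2 a') (by linarith : 0 ≤ ν * deriv (u t) x + (ν + 1))]
  have c := h.cx1 ht
  rw [← intervalIntegral.integral_const_mul]
  calc ∫ x in (0:ℝ)..1, ν * (deriv (u t) x) ^ 2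
      ≤ ∫ x in (0:ℝ)..1, ((ν + 1) - deriv (u t) x) :=
        intervalIntegral.integral_mono_on zero_le_one
          (Continuous.intervalIntegrable (by fun_prop) _ _)
          (Continuous.intervalIntegrable (by fun_prop) _ _) (fun x _ => hp x)
    _ = ν + 1 := by
        rw [intervalIntegral.integral_sub (by simp) (c.intervalIntegrable _ _), h.int_deriv ht]
        simp

lemma ux0 (h : Bur ν u) (t : ℝ) : u t 1 = u t 0 ∧ deriv (u t) 1 = deriv (u t) 0 := by
  have h1 := h.per t 0
  have h2 := h.per' t 0
  rw [zero_add] at h1 h2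
  exact ⟨h1, h2⟩

lemma mean (h : Bur ν u) {T : ℝ} (hT : 0 ≤ T) :
    ∫ x in (0:ℝ)..1, u T x = ∫ x in (0:ℝ)..1, u 0 x := by
  have a := h.sm.continuousOn
  have b := h.sm.dx.continuousOn
  have c := h.sm.dx.dx.continuousOn
  have key := time_int (h := u)
    (q := fun t x => ν * deriv (deriv (u t)) x - u t x * deriv (u t) x) a
    ((c.const_mul ν).sub (a.mul b)) (fun t x ht => h.ut ht x) T hT
  have z : ∫ t in (0:ℝ)..T, ∫ x in (0:ℝ)..1,
      (ν * deriv (deriv (u t)) x - u t x * deriv (u t) x) = ∫ t in (0:ℝ)..T, (0:ℝ) := by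
    refine intervalIntegral.integral_congr ?_
    intro t ht
    rw [Set.uIcc_of_le hT] at ht
    have ht := ht.1
    have c0 := h.cx ht
    have c1 := h.cx1 ht
    have c2 := h.cx2 ht
    simp only
    rw [intervalIntegral.integral_eq_sub_of_hasDerivAt
      (f := fun x => ν * deriv (u t) x - (u t x) ^ 2 / 2) ?_
      (Continuous.intervalIntegrable (by fun_prop) _ _)]
    · simp only [(h.ux0 t).1, (h.ux0 t).2, sub_self]
    · intro x _
      refine (((h.hx2 ht x).const_mul ν).sub (((h.hx1 ht x).pow 2).div_const 2)).congr_deriv ?_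
      push_cast; ring
  rw [z] at key
  simp at key
  linarith

lemma energy (h : Bur ν u) {T B : ℝ} (hT : 0 ≤ T)
    (hB : ∀ t, 0 ≤ t → ν * ∫ x in (0:ℝ)..1, (deriv (u t) x) ^ 2 ≤ B) :
    (∫ x in (0:ℝ)..1, (u 0 x) ^ 2) - (∫ x in (0:ℝ)..1, (u T x) ^ 2) ≤ 2 * B * T := by
  have a := h.sm.continuousOn
  have b := h.sm.dx.continuousOn
  have c := h.sm.dx.dx.continuousOn
  have a2 : ContinuousOn (Function.uncurry fun t x => (u t x) ^ 2) (Set.Ici 0 ×ˢ Set.univ) :=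
    a.pow 2
  have key := time_int (h := fun t x => (u t x) ^ 2)
    (q := fun t x => 2 * u t x * (ν * deriv (deriv (u t)) x - u t x * deriv (u t) x)) a2
    ((a.const_mul 2).mul ((c.const_mul ν).sub (a.mul b)))
    (fun t x ht => ((h.ut ht x).pow 2).congr_deriv (by push_cast; ring)) T hT
  have z : ∀ t, 0 ≤ t → ∫ x in (0:ℝ)..1,
      2 * u t x * (ν * deriv (deriv (u t)) x - u t x * deriv (u t) x)
        = - 2 * (ν * ∫ x in (0:ℝ)..1, (deriv (u t) x) ^ 2) := by
    intro t ht
    have c0 := h.cx ht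
    have c1 := h.cx1 ht
    have c2 := h.cx2 ht
    rw [← intervalIntegral.integral_const_mul, ← intervalIntegral.integral_const_mul,
      ← sub_eq_zero, ← intervalIntegral.integral_sub
        (Continuous.intervalIntegrable (by fun_prop) _ _)
        (Continuous.intervalIntegrable (by fun_prop) _ _)]
    rw [intervalIntegral.integral_eq_sub_of_hasDerivAt
      (f := fun x => 2 * ν * (u t x * deriv (u t) x) - 2 * (u t x) ^ 3 / 3) ?_
      (Continuous.intervalIntegrable (by fun_prop) _ _)]
    · simp only [(h.ux0 t).1, (h.ux0 t).2, sub_self]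
    · intro x _
      refine ((((h.hx1 ht x).mul (h.hx2 ht x)).const_mul (2 * ν)).sub
        ((((h.hx1 ht x).pow 3).const_mul 2).div_const 3)).congr_deriv ?_
      push_cast; ring
  have bd := intervalIntegral.norm_integral_le_of_norm_le_const (a := 0) (b := T) (C := 2 * B)
    (f := fun t => ∫ x in (0:ℝ)..1,
      2 * u t x * (ν * deriv (deriv (u t)) x - u t x * deriv (u t) x)) (by
    intro t ht
    rw [Set.uIoc_of_le hT] at ht
    have ht := ht.1.le
    simp only [z t ht]
    have : 0 ≤ ∫ x in (0:ℝ)..1, (deriv (u t) x) ^ 2 :=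
      intervalIntegral.integral_nonneg zero_le_one (fun x _ => sq_nonneg _)
    have := mul_nonneg h.pos.le this
    rw [Real.norm_eq_abs, abs_le]
    constructor <;> linarith [hB t ht])
  rw [← key, sub_zero, abs_of_nonneg hT, Real.norm_eq_abs] at bd
  linarith [(abs_le.1 bd).1]

lemma decay (h : Bur ν u) (h0 : ∀ x, deriv (u 0) x ≤ 1) (hm : ∫ x in (0:ℝ)..1, u 0 x = 0)
    {T : ℝ} (hT : 0 < T) (x : ℝ) : |u T x| ≤ 1 / T := by
  have hd : ∀ x, deriv (u T) x ≤ 1 / T := by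
    intro x
    have := h.oleinik h0 hT.le x
    rw [le_div_iff₀ hT]
    by_contra! hn
    have : 0 < deriv (u T) x := by
      by_contra! hn'
      nlinarith
    nlinarith
  have hT' : 0 < 1 / T := by positivity
  have osc1 : ∀ x y, y ≤ x → u T x - u T y ≤ 1 / T * (x - y) := by
    intro x y hxy
    exact image_sub_le_mul_sub_of_deriv_le
      (fun x => (h.hx1 hT.le x).differentiableAt) hd hxy
  have osc : ∀ x y, u T x - u T y ≤ 1 / T := by
    intro x y
    obtain ⟨x', hx', ex⟩ := per_int (h.per T) x
    obtain ⟨y', hy', ey⟩ := per_int (h.per T) y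
    rw [← ex, ← ey]
    rcases le_total y' x' with hl | hl
    · have := osc1 x' y' hl
      have : 1 / T * (x' - y') ≤ 1 / T * 1 :=
        mul_le_mul_of_nonneg_left (by linarith [hx'.2, hy'.1]) hT'.le
      linarith
    · have := osc1 (x' + 1) y' (by linarith [hx'.1, hy'.2])
      rw [h.per] at this
      have : 1 / T * (x' + 1 - y') ≤ 1 / T * 1 :=
        mul_le_mul_of_nonneg_left (by linarith) hT'.le
      linarith
  have hm' := (h.mean hT.le).trans hm
  have c := h.cx hT.le
  have up : ∫ y in (0:ℝ)..1, (u T x - u T y) ≤ ∫ y in (0:ℝ)..1, 1 / T :=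
    intervalIntegral.integral_mono_on zero_le_one
      (Continuous.intervalIntegrable (by fun_prop) _ _) (by simp) (fun y _ => osc x y)
  have lo : ∫ y in (0:ℝ)..1, (u T y - u T x) ≤ ∫ y in (0:ℝ)..1, 1 / T :=
    intervalIntegral.integral_mono_on zero_le_one
      (Continuous.intervalIntegrable (by fun_prop) _ _) (by simp) (fun y _ => osc y x)
  rw [intervalIntegral.integral_sub (by simp) (c.intervalIntegrable _ _), hm'] at up
  rw [intervalIntegral.integral_sub (c.intervalIntegrable _ _) (by simp), hm'] at lo
  simp only [intervalIntegral.integral_const, sub_zero, smul_eq_mul, one_mul, zero_sub] at up lo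
  rw [abs_le]
  constructor <;> linarith

end Bur

lemma u0_deriv : deriv (fun x : ℝ => Real.sin (2 * Real.pi * x) / 10)
    = fun x => Real.cos (2 * Real.pi * x) * (2 * Real.pi) / 10 := by
  funext x
  have h1 : HasDerivAt (fun x : ℝ => 2 * Real.pi * x) (2 * Real.pi) x := by
    simpa using (hasDerivAt_id x).const_mul (2 * Real.pi)
  exact (h1.sin.div_const 10).deriv

lemma u0_bd (x : ℝ) : |deriv (fun x : ℝ => Real.sin (2 * Real.pi * x) / 10) x| ≤ 1 := by
  rw [u0_deriv]
  have h1 := Real.pi_pos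
  have h2 := Real.pi_lt_four
  have h3 := Real.neg_one_le_cos (2 * Real.pi * x)
  have h4 := Real.cos_le_one (2 * Real.pi * x)
  rw [abs_le]
  constructor <;> simp only <;> nlinarith

/-- **Theorem (Lower bound on enstrophy growth for viscous Burgers).**
Functions on the unit circle 𝕋 = ℝ/ℤ are modelled as 1-periodic functions on ℝ,
with integrals over the fundamental domain `[0,1]`.  The supremum over times
`t ≥ 0` of the enstrophy is taken as a supremum over the subtype `Set.Ici 0`,
and the liminf as `ν → 0⁺` is taken along the filter `𝓝[>] 0`. -/
theorem enstrophy_lower_bound_burgers :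
    ∃ (u₀ : ℝ → ℝ) (c₀ : ℝ), 0 < c₀ ∧
      ContDiff ℝ (⊤ : ℕ∞) u₀ ∧
      (∀ x, u₀ (x + 1) = u₀ x) ∧
      (∫ x in (0:ℝ)..1, u₀ x) = 0 ∧
      (∫ x in (0:ℝ)..1, (deriv u₀ x) ^ 2) ≤ 1 ∧
      ∀ (U : ℝ → ℝ → ℝ → ℝ),
        (∀ ν, 0 < ν →
          ContDiffOn ℝ (⊤ : ℕ∞) (Function.uncurry (U ν)) (Set.Ici 0 ×ˢ Set.univ) ∧
          (∀ t x, U ν t (x + 1) = U ν t x) ∧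
          (∀ x, U ν 0 x = u₀ x) ∧
          (∀ t x, 0 < t →
            deriv (fun s => U ν s x) t + U ν t x * deriv (U ν t) x
              = ν * deriv (deriv (U ν t)) x)) →
        c₀ ≤ Filter.liminf
          (fun ν => ν * ⨆ t : Set.Ici (0:ℝ),
            ∫ x in (0:ℝ)..1, (deriv (U ν t.1) x) ^ 2)
          (nhdsWithin 0 (Set.Ioi 0)) := by
  refine ⟨fun x => Real.sin (2 * Real.pi * x) / 10, 1 / 16000, by norm_num, ?_, ?_, ?_, ?_, ?_⟩
  · fun_prop
  · intro x
    simp only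
    rw [mul_add, mul_one, Real.sin_add_two_pi]
  · rw [intervalIntegral.integral_div, intervalIntegral.integral_comp_mul_left (f := Real.sin)
      (by positivity)]
    simp
  · have hc : Continuous (deriv (fun x : ℝ => Real.sin (2 * Real.pi * x) / 10)) := by
      rw [u0_deriv]; fun_prop
    calc _ ≤ ∫ x in (0:ℝ)..1, (1:ℝ) :=
          intervalIntegral.integral_mono_on zero_le_one
            (Continuous.intervalIntegrable (by fun_prop) _ _) (by simp)
            (fun x _ => by
              rw [← sq_abs]; exact pow_le_one₀ (abs_nonneg _) (u0_bd x))
      _ = 1 := by simp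
  · intro U hU
    have hB : ∀ ν, 0 < ν → Bur ν (U ν) := fun ν hν =>
      ⟨hν, (hU ν hν).1, (hU ν hν).2.1, (hU ν hν).2.2.2⟩
    have h00 : ∀ ν, 0 < ν → U ν 0 = fun x => Real.sin (2 * Real.pi * x) / 10 := fun ν hν =>
      funext (hU ν hν).2.2.1
    have h0 : ∀ ν, 0 < ν → ∀ x, |deriv (U ν 0) x| ≤ 1 := by
      intro ν hν x
      rw [h00 ν hν]; exact u0_bd x
    have h1 : ∀ ν, 0 < ν → ∀ x, (U ν 0 x) ^ 2 ≤ 1 := by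
      intro ν hν x
      rw [h00 ν hν]
      simp only
      nlinarith [Real.sin_sq_le_one (2 * Real.pi * x)]
    have hm : ∀ ν, 0 < ν → ∫ x in (0:ℝ)..1, U ν 0 x = 0 := by
      intro ν hν
      rw [h00 ν hν]
      rw [intervalIntegral.integral_div, intervalIntegral.integral_comp_mul_left (f := Real.sin)
        (by positivity)]
      simp
    have he : ∀ ν, 0 < ν → ∫ x in (0:ℝ)..1, (U ν 0 x) ^ 2 = 1 / 200 := by
      intro ν hν
      rw [h00 ν hν]
      simp only [div_pow]
      rw [intervalIntegral.integral_div, intervalIntegral.integral_comp_mul_left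
        (f := fun y => Real.sin y ^ 2) (by positivity), integral_sin_sq]
      simp
      field_simp
      norm_num
    have hup : ∀ ν, 0 < ν → ∀ t : Set.Ici (0:ℝ),
        ∫ x in (0:ℝ)..1, (deriv (U ν t.1) x) ^ 2 ≤ (ν + 1) / ν := by
      intro ν hν t
      rw [le_div_iff₀ hν, mul_comm]
      exact (hB ν hν).upper (h0 ν hν) (h1 ν hν) t.2
    have hpos : ∀ᶠ ν in nhdsWithin (0:ℝ) (Set.Ioi 0), 0 < ν := self_mem_nhdsWithin
    have hlt : ∀ᶠ ν in nhdsWithin (0:ℝ) (Set.Ioi 0), ν < 1 :=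
      mem_nhdsWithin_of_mem_nhds (Iio_mem_nhds one_pos)
    haveI : Nonempty (Set.Ici (0:ℝ)) := ⟨⟨0, Set.self_mem_Ici⟩⟩
    refine Filter.le_liminf_of_le ?_ ?_
    · refine Filter.isCoboundedUnder_ge_of_eventually_le _ (x := 2) ?_
      filter_upwards [hpos, hlt] with ν hν hν1
      calc _ ≤ ν * ((ν + 1) / ν) :=
            mul_le_mul_of_nonneg_left (ciSup_le (hup ν hν)) hν.le
        _ = ν + 1 := by field_simp
        _ ≤ 2 := by linarith
    · filter_upwards [hpos] with ν hν
      have hb : BddAbove (Set.range (fun t : Set.Ici (0:ℝ) =>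
          ∫ x in (0:ℝ)..1, (deriv (U ν t.1) x) ^ 2)) :=
        ⟨_, by rintro _ ⟨t, rfl⟩; exact hup ν hν t⟩
      have hen := (hB ν hν).energy (T := 20) (by norm_num)
        (B := ν * ⨆ t : Set.Ici (0:ℝ), ∫ x in (0:ℝ)..1, (deriv (U ν t.1) x) ^ 2)
        (fun t ht => mul_le_mul_of_nonneg_left (le_ciSup hb ⟨t, ht⟩) hν.le)
      have hc := (hB ν hν).cx (t := 20) (by norm_num)
      have hT : ∫ x in (0:ℝ)..1, (U ν 20 x) ^ 2 ≤ 1 / 400 := by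
        calc _ ≤ ∫ x in (0:ℝ)..1, (1 / 400 : ℝ) :=
              intervalIntegral.integral_mono_on zero_le_one
                (Continuous.intervalIntegrable (by fun_prop) _ _) (by simp)
                (fun x _ => by
                  have := (hB ν hν).decay (fun x => (abs_le.1 (h0 ν hν x)).2) (hm ν hν)
                    (T := 20) (by norm_num) x
                  have h2 := abs_le.1 this
                  nlinarith [h2.1, h2.2])
          _ = 1 / 400 := by simp
      rw [he ν hν] at hen
      linarith
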